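/- Let n ≥ 1, ν₀ ∈ ℝ, let h_{αβ} : ℝ^n → ℝ^{n×n} be a smooth constant-curvature metric with R^{(h)α}{}_{βγδ} = ν₀(δ^α_γ h_{δβ} − δ^α_δ h_{γβ}), let k_{αβ}(y) be a smooth symmetric 2-tensor, and let Γ be the induced Carrollian connection on ℝ × ℝ^n (Γ^α_{βγ} = Christoffels of h, Γ^u_{βγ} = ν₀(½k_{βγ} + u h_{βγ}), other components zero). Let X = ω(y)∂_u + Σ_α χ^α(y)∂_α with χ a Killing vector of h. Then the Lie derivative of the connection, (L_XΓ)^a_{bc} := X^d∂_dΓ^a_{bc} − (∂_dX^a)Γ^d_{bc} + Γ^a_{dc}∂_bX^d + Γ^a_{bd}∂_cX^d + ∂_b∂_cX^a, vanishes identically (i.e. X is an automorphism of the strongly Carrollian geometry) if and only if ω satisfies, for all β, γ: D_βD_γω + ν₀ h_{βγ} ω = −(ν₀/2)(L_χ k)_{βγ}, where (L_χ k)_{βγ} = Σ_δ ( χ^δ∂_δ k_{βγ} + k_{δγ}∂_βχ^δ + k_{βδ}∂_γχ^δ ) and D_βD_γω = ∂_β∂_γω − Γ^δ_{βγ}∂_δω.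 -/

import Mathlib

open scoped BigOperators
open Filter MeasureTheory

noncomputable section

/-- Partial derivative in the `i`-th coordinate direction. -/
def pdv {m : ℕ} {F : Type*} [NormedAddCommGroup F] [NormedSpace ℝ F]
    (i : Fin m) (f : (Fin m → ℝ) → F) (x : Fin m → ℝ) : F :=
  fderiv ℝ f x (Pi.single i 1)

/-- Extension of a spatial 2-tensor on `ℝⁿ` by zero to adapted coordinates on `ℝ × ℝⁿ`. -/
def spatialExt (n : ℕ) (T : Fin n → Fin n → ℝ) (b c : Fin (n+1)) : ℝ :=
  Fin.cases (motive := fun _ => ℝ) 0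
    (fun β => Fin.cases (motive := fun _ => ℝ) 0 (fun γ => T β γ) c) b

/-- Christoffel symbols `Γ^γ_{αβ}` of a metric `h_{αβ}` on `ℝⁿ` (via the matrix inverse). -/
def ChrG (n : ℕ) (hmat : (Fin n → ℝ) → Fin n → Fin n → ℝ)
    (y : Fin n → ℝ) (γ α β : Fin n) : ℝ :=
  (1/2) * ∑ δ, (Matrix.of (hmat y))⁻¹ γ δ *
    (pdv α (fun y => hmat y δ β) y + pdv β (fun y => hmat y δ α) y
      - pdv δ (fun y => hmat y α β) y)

/-- The Riemann curvature tensor `R^α_{βγδ}` of a metric `h_{αβ}` on `ℝⁿ`. -/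
def Riem (n : ℕ) (hmat : (Fin n → ℝ) → Fin n → Fin n → ℝ)
    (y : Fin n → ℝ) (α β γ δ : Fin n) : ℝ :=
  pdv γ (fun y => ChrG n hmat y α δ β) y - pdv δ (fun y => ChrG n hmat y α γ β) y
    + ∑ ε, (ChrG n hmat y α γ ε * ChrG n hmat y ε δ β
        - ChrG n hmat y α δ ε * ChrG n hmat y ε γ β)

/-- The Carrollian connection induced on `Spi/Ti`:
`Γ^α_{βγ}` are the Christoffel symbols of `h` and `Γ^u_{βγ} = ν₀(½k_{βγ} + u h_{βγ})`. -/
def Γind (n : ℕ) (ν₀ : ℝ) (hmat kmat : (Fin n → ℝ) → Fin n → Fin n → ℝ)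
    (x : Fin (n+1) → ℝ) (a b c : Fin (n+1)) : ℝ :=
  Fin.cases (motive := fun _ => ℝ)
    (spatialExt n
      (fun β γ => ν₀ * ((1/2) * kmat (x ∘ Fin.succ) β γ + x 0 * hmat (x ∘ Fin.succ) β γ))
      b c)
    (fun α => spatialExt n (fun β γ => ChrG n hmat (x ∘ Fin.succ) α β γ) b c)
    a

/-- The vector field `X = ω(y)∂_u + χ^α(y)∂_α` on `ℝ × ℝⁿ`. -/
def XfieldTi (n : ℕ) (ω : (Fin n → ℝ) → ℝ) (χ : (Fin n → ℝ) → Fin n → ℝ)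
    (x : Fin (n+1) → ℝ) (a : Fin (n+1)) : ℝ :=
  Fin.cases (motive := fun _ => ℝ) (ω (x ∘ Fin.succ)) (fun α => χ (x ∘ Fin.succ) α) a

/-- The Lie derivative of a connection along a vector field:
`(L_XΓ)^a_{bc} = X^d∂_dΓ^a_{bc} - (∂_dX^a)Γ^d_{bc} + Γ^a_{dc}∂_bX^d + Γ^a_{bd}∂_cX^d
  + ∂_b∂_cX^a`. -/
def LieConn (n : ℕ) (Γ : (Fin (n+1) → ℝ) → Fin (n+1) → Fin (n+1) → Fin (n+1) → ℝ)
    (X : (Fin (n+1) → ℝ) → Fin (n+1) → ℝ)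
    (x : Fin (n+1) → ℝ) (a b c : Fin (n+1)) : ℝ :=
  (∑ d, X x d * pdv d (fun x => Γ x a b c) x)
    - (∑ d, pdv d (fun x => X x a) x * Γ x d b c)
    + (∑ d, Γ x a d c * pdv b (fun x => X x d) x)
    + (∑ d, Γ x a b d * pdv c (fun x => X x d) x)
    + pdv b (pdv c (fun x => X x a)) x


section PartialDerivatives

variable {m : ℕ} {f g : (Fin m → ℝ) → ℝ} {x : Fin m → ℝ}

lemma pdv_const (i : Fin m) (c : ℝ) : pdv i (fun _ => c) x = 0 := by
  simp [pdv]

lemma pdv_add (i : Fin m) (hf : DifferentiableAt ℝ f x) (hg : DifferentiableAt ℝ g x) :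
    pdv i (fun y => f y + g y) x = pdv i f x + pdv i g x := by
  simp [pdv, fderiv_fun_add hf hg]

lemma pdv_sub (i : Fin m) (hf : DifferentiableAt ℝ f x) (hg : DifferentiableAt ℝ g x) :
    pdv i (fun y => f y - g y) x = pdv i f x - pdv i g x := by
  simp [pdv, fderiv_fun_sub hf hg]

lemma pdv_mul (i : Fin m) (hf : DifferentiableAt ℝ f x) (hg : DifferentiableAt ℝ g x) :
    pdv i (fun y => f y * g y) x = pdv i f x * g x + f x * pdv i g x := by
  simp [pdv, fderiv_fun_mul hf hg]
  ring

lemma pdv_const_mul (i : Fin m) (c : ℝ) (hf : DifferentiableAt ℝ f x) :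
    pdv i (fun y => c * f y) x = c * pdv i f x := by
  simp [pdv, fderiv_const_mul hf]

lemma pdv_sum {ι : Type*} [Fintype ι] {f : ι → (Fin m → ℝ) → ℝ} (i : Fin m)
    (hf : ∀ j, DifferentiableAt ℝ (f j) x) :
    pdv i (fun y => ∑ j, f j y) x = ∑ j, pdv i (f j) x := by
  simp [pdv, fderiv_fun_sum fun j _ => hf j]

lemma contDiff_pdv (i : Fin m) (hf : ContDiff ℝ (⊤ : ℕ∞) f) :
    ContDiff ℝ (⊤ : ℕ∞) (pdv i f) :=
  (hf.fderiv_right (m := (⊤ : ℕ∞)) (by simp)).clm_apply contDiff_const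

lemma pdv_comm (i j : Fin m) (hf : ContDiff ℝ (⊤ : ℕ∞) f) :
    pdv i (pdv j f) x = pdv j (pdv i f) x := by
  have hd : DifferentiableAt ℝ (fderiv ℝ f) x :=
    (hf.fderiv_right (m := (⊤ : ℕ∞)) (by simp)).differentiable (by simp) x
  have key (k l : Fin m) : pdv k (pdv l f) x
      = fderiv ℝ (fderiv ℝ f) x (Pi.single k 1) (Pi.single l 1) := by
    unfold pdv
    rw [fderiv_clm_apply hd (differentiableAt_const _)]
    simp
  rw [key, key]
  refine (hf.contDiffAt.isSymmSndFDerivAt ?_).eq _ _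
  rw [minSmoothness_of_isRCLikeNormedField]
  exact WithTop.coe_le_coe.2 (le_top : (2 : ℕ∞) ≤ ⊤)

lemma pdv_zero_coord {x : Fin (m + 1) → ℝ} :
    pdv 0 (fun x : Fin (m + 1) → ℝ => x 0) x = 1 := by
  simp [pdv, fderiv_apply]

lemma pdv_succ_coord_zero {x : Fin (m + 1) → ℝ} (i : Fin m) :
    pdv i.succ (fun x : Fin (m + 1) → ℝ => x 0) x = 0 := by
  simp [pdv, fderiv_apply]

lemma hasFDerivAt_comp_succ (x : Fin (m + 1) → ℝ) (hf : DifferentiableAt ℝ f (x ∘ Fin.succ)) :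
    HasFDerivAt (fun x : Fin (m + 1) → ℝ => f (x ∘ Fin.succ))
      ((fderiv ℝ f (x ∘ Fin.succ)).comp
        (ContinuousLinearMap.pi fun i : Fin m => ContinuousLinearMap.proj i.succ)) x :=
  HasFDerivAt.comp x (f := fun x : Fin (m + 1) → ℝ => x ∘ Fin.succ) hf.hasFDerivAt
    (hasFDerivAt_pi.2 fun i => hasFDerivAt_apply i.succ x)

lemma pdv_zero_comp_succ (x : Fin (m + 1) → ℝ) (hf : DifferentiableAt ℝ f (x ∘ Fin.succ)) :
    pdv 0 (fun x : Fin (m + 1) → ℝ => f (x ∘ Fin.succ)) x = 0 := by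
  have : (fun i : Fin m => (Pi.single 0 1 : Fin (m + 1) → ℝ) i.succ) = 0 := by
    ext i; simp
  rw [pdv, (hasFDerivAt_comp_succ x hf).fderiv]
  change fderiv ℝ f (x ∘ Fin.succ) (fun i : Fin m => (Pi.single 0 1 : Fin (m + 1) → ℝ) i.succ) = 0
  rw [this, map_zero]

lemma pdv_succ_comp_succ (i : Fin m) (x : Fin (m + 1) → ℝ)
    (hf : DifferentiableAt ℝ f (x ∘ Fin.succ)) :
    pdv i.succ (fun x : Fin (m + 1) → ℝ => f (x ∘ Fin.succ)) x = pdv i f (x ∘ Fin.succ) := by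
  have : (fun j : Fin m => (Pi.single i.succ 1 : Fin (m + 1) → ℝ) j.succ) = Pi.single i 1 := by
    ext j; simp [Pi.single_apply]
  rw [pdv, (hasFDerivAt_comp_succ x hf).fderiv]
  change fderiv ℝ f (x ∘ Fin.succ)
    (fun j : Fin m => (Pi.single i.succ 1 : Fin (m + 1) → ℝ) j.succ) = _
  rw [this, pdv]

end PartialDerivatives

section Christoffel

variable {n : ℕ} {hmat : (Fin n → ℝ) → Fin n → Fin n → ℝ}

lemma contDiff_matrix_det {E : Type*} [NormedAddCommGroup E] [NormedSpace ℝ E]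
    {A : E → Matrix (Fin n) (Fin n) ℝ} {k : WithTop ℕ∞}
    (hA : ∀ i j, ContDiff ℝ k fun y => A y i j) : ContDiff ℝ k fun y => (A y).det := by
  simp only [Matrix.det_apply]
  exact ContDiff.sum fun σ _ => (contDiff_prod fun i _ => hA _ _).const_smul _

lemma contDiff_matrix_inv_apply {E : Type*} [NormedAddCommGroup E] [NormedSpace ℝ E]
    {A : E → Matrix (Fin n) (Fin n) ℝ} {k : WithTop ℕ∞}
    (hA : ∀ i j, ContDiff ℝ k fun y => A y i j) (hdet : ∀ y, IsUnit (A y).det) (i j : Fin n) :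
    ContDiff ℝ k fun y => (A y)⁻¹ i j := by
  simp only [Matrix.inv_def, Ring.inverse_eq_inv', Matrix.smul_apply, smul_eq_mul,
    Matrix.adjugate_apply]
  refine ((contDiff_matrix_det hA).inv fun y => (hdet y).ne_zero).mul
    (contDiff_matrix_det fun a b => ?_)
  simp only [Matrix.updateRow_apply]
  split_ifs
  · exact contDiff_const
  · exact hA a b

lemma contDiff_component {T : (Fin n → ℝ) → Fin n → Fin n → ℝ} {k : WithTop ℕ∞}
    (hT : ContDiff ℝ k T) (α β : Fin n) : ContDiff ℝ k fun y => T y α β :=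
  contDiff_pi.1 (contDiff_pi.1 hT α) β

lemma contDiff_ChrG (hsm : ContDiff ℝ (⊤ : ℕ∞) hmat)
    (hinvert : ∀ y, IsUnit (Matrix.of (hmat y)).det) (γ α β : Fin n) :
    ContDiff ℝ (⊤ : ℕ∞) fun y => ChrG n hmat y γ α β := by
  have hc := contDiff_component hsm
  exact contDiff_const.mul <| ContDiff.sum fun δ _ =>
    (contDiff_matrix_inv_apply (A := fun y => Matrix.of (hmat y)) hc hinvert γ δ).mul
      (((contDiff_pdv α (hc δ β)).add (contDiff_pdv β (hc δ α))).sub (contDiff_pdv δ (hc α β)))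

/-- Lowering the upper index of `Γ^ε_{αβ}` gives the Christoffel symbols of the first kind. -/
lemma sum_metric_mul_ChrG {y : Fin n → ℝ} (hy : IsUnit (Matrix.of (hmat y)).det)
    (δ α β : Fin n) :
    ∑ ε, hmat y δ ε * ChrG n hmat y ε α β
      = (1/2) * (pdv α (fun y => hmat y δ β) y + pdv β (fun y => hmat y δ α) y
          - pdv δ (fun y => hmat y α β) y) := by
  set v : Fin n → ℝ := fun δ => pdv α (fun y => hmat y δ β) y + pdv β (fun y => hmat y δ α) y
    - pdv δ (fun y => hmat y α β) y with hv
  have h1 : (Matrix.of (hmat y)).mulVec ((Matrix.of (hmat y))⁻¹.mulVec v) = v := by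
    rw [Matrix.mulVec_mulVec, Matrix.mul_nonsing_inv _ hy, Matrix.one_mulVec]
  have h2 := congrFun h1 δ
  change _ = (1/2) * v δ
  rw [← h2]
  simp only [Matrix.mulVec, dotProduct, Matrix.of_apply, Finset.mul_sum, ChrG, hv]
  exact Finset.sum_congr rfl fun ε _ => Finset.sum_congr rfl fun ζ _ => by ring

/-- The pointwise tensor algebra behind the invariance of the Christoffel symbols: `h`, `dh`, `ddh`,
`c`, `dc`, `ddc`, `G`, `dG` are the values of the metric, the Killing vector and the Christoffel
symbols together with their derivatives, derivative indices first. -/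
lemma lowered_lieDeriv_christoffel_eq_zero
    {h : Fin n → Fin n → ℝ} {dh : Fin n → Fin n → Fin n → ℝ}
    {ddh : Fin n → Fin n → Fin n → Fin n → ℝ} {c : Fin n → ℝ} {dc : Fin n → Fin n → ℝ}
    {ddc : Fin n → Fin n → Fin n → ℝ} {G : Fin n → Fin n → Fin n → ℝ}
    {dG : Fin n → Fin n → Fin n → Fin n → ℝ}
    (h_symm : ∀ α β, h α β = h β α) (dh_symm : ∀ μ α β, dh μ α β = dh μ β α)
    (ddh_comm : ∀ μ ν α β, ddh μ ν α β = ddh ν μ α β)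
    (ddc_comm : ∀ μ ν α, ddc μ ν α = ddc ν μ α)
    (hK : ∀ α β, ∑ γ, (c γ * dh γ α β + h γ β * dc α γ + h α γ * dc β γ) = 0)
    (hdK : ∀ μ α β, ∑ γ, ((dc μ γ * dh γ α β + c γ * ddh μ γ α β)
      + (dh μ γ β * dc α γ + h γ β * ddc μ α γ) + (dh μ α γ * dc β γ + h α γ * ddc μ β γ)) = 0)
    (hG : ∀ δ α β, ∑ ε, h δ ε * G ε α β = (1/2) * (dh α δ β + dh β δ α - dh δ α β))
    (hdG : ∀ μ δ α β, ∑ ε, (dh μ δ ε * G ε α β + h δ ε * dG μ ε α β)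
      = (1/2) * (ddh μ α δ β + ddh μ β δ α - ddh μ δ α β))
    (ζ α β : Fin n) :
    ∑ δ, h ζ δ * ((∑ γ, c γ * dG γ δ α β) - (∑ γ, dc γ δ * G γ α β)
      + (∑ γ, G δ γ β * dc α γ) + (∑ γ, G δ α γ * dc β γ) + ddc α β δ) = 0 := by
  have e1 : ∑ δ, h ζ δ * ∑ γ, c γ * dG γ δ α β
      = ∑ γ, c γ * ((1/2) * (ddh γ α ζ β + ddh γ β ζ α - ddh γ ζ α β))
        - ∑ δ, (∑ γ, c γ * dh γ ζ δ) * G δ α β := by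
    simp only [← hdG, Finset.mul_sum, Finset.sum_mul]
    rw [Finset.sum_comm, Finset.sum_comm (f := fun δ γ => c γ * dh γ ζ δ * G δ α β),
      ← Finset.sum_sub_distrib]
    refine Finset.sum_congr rfl fun γ _ => ?_
    rw [← Finset.sum_sub_distrib]
    exact Finset.sum_congr rfl fun δ _ => by ring
  have e2 : ∑ δ, (∑ γ, c γ * dh γ ζ δ) * G δ α β
      = - (∑ γ, dc ζ γ * ((1/2) * (dh α γ β + dh β γ α - dh γ α β)))
        - ∑ δ, h ζ δ * ∑ γ, dc γ δ * G γ α β := by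
    have hK' (δ : Fin n) : ∑ γ, c γ * dh γ ζ δ
        = - (∑ γ, h γ δ * dc ζ γ) - ∑ γ, h ζ γ * dc δ γ := by
      have := hK ζ δ
      simp only [Finset.sum_add_distrib] at this
      linarith
    simp only [hK', ← hG, Finset.mul_sum, Finset.sum_mul, sub_mul, neg_mul,
      Finset.sum_sub_distrib, Finset.sum_neg_distrib]
    congr 1
    · rw [Finset.sum_comm]
      congr 1
      exact Finset.sum_congr rfl fun _ _ => Finset.sum_congr rfl fun _ _ => by ring
    · rw [Finset.sum_comm]
      exact Finset.sum_congr rfl fun _ _ => Finset.sum_congr rfl fun _ _ => by ring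
  have e3 : ∑ δ, h ζ δ * ∑ γ, G δ γ β * dc α γ
      = ∑ γ, dc α γ * ((1/2) * (dh γ ζ β + dh β ζ γ - dh ζ γ β)) := by
    simp only [← hG, Finset.mul_sum]
    rw [Finset.sum_comm]
    exact Finset.sum_congr rfl fun _ _ => Finset.sum_congr rfl fun _ _ => by ring
  have e4 : ∑ δ, h ζ δ * ∑ γ, G δ α γ * dc β γ
      = ∑ γ, dc β γ * ((1/2) * (dh α ζ γ + dh γ ζ α - dh ζ α γ)) := by
    simp only [← hG, Finset.mul_sum]
    rw [Finset.sum_comm]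
    exact Finset.sum_congr rfl fun _ _ => Finset.sum_congr rfl fun _ _ => by ring
  have first_kind : (1/2 : ℝ) * (0 + 0 - 0)
      = ∑ γ, (c γ * ((1/2) * (ddh γ α ζ β + ddh γ β ζ α - ddh γ ζ α β))
        + dc ζ γ * ((1/2) * (dh α γ β + dh β γ α - dh γ α β))
        + dc α γ * ((1/2) * (dh γ ζ β + dh β ζ γ - dh ζ γ β))
        + dc β γ * ((1/2) * (dh α ζ γ + dh γ ζ α - dh ζ α γ))
        + h ζ γ * ddc α β γ) := by
    nth_rw 1 [← hdK α ζ β]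
    nth_rw 1 [← hdK β ζ α]
    rw [← hdK ζ α β, ← Finset.sum_add_distrib, ← Finset.sum_sub_distrib, Finset.mul_sum]
    refine Finset.sum_congr rfl fun γ _ => ?_
    rw [ddh_comm γ α, ddh_comm γ β, ddh_comm γ ζ, ddc_comm ζ α, ddc_comm ζ β, ddc_comm β α,
      h_symm γ α, h_symm γ β, dh_symm β γ α, dh_symm ζ γ β, dh_symm α γ β]
    ring
  simp only [Finset.sum_add_distrib] at first_kind
  simp only [mul_add, mul_sub, Finset.sum_add_distrib, Finset.sum_sub_distrib] at *
  linarith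

/-- Killing vector fields preserve the Levi-Civita connection. -/
lemma lieDeriv_ChrG_eq_zero_of_killing (hsm : ContDiff ℝ (⊤ : ℕ∞) hmat)
    (hsym : ∀ (y : Fin n → ℝ) (α β : Fin n), hmat y α β = hmat y β α)
    (hinvert : ∀ y : Fin n → ℝ, IsUnit (Matrix.of (hmat y)).det)
    {χ : (Fin n → ℝ) → Fin n → ℝ} (hχsm : ContDiff ℝ (⊤ : ℕ∞) χ)
    (hkilling : ∀ (y : Fin n → ℝ) (α β : Fin n),
      ∑ γ, (χ y γ * pdv γ (fun y => hmat y α β) y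
        + hmat y γ β * pdv α (fun y => χ y γ) y
        + hmat y α γ * pdv β (fun y => χ y γ) y) = 0)
    (y : Fin n → ℝ) (δ α β : Fin n) :
    (∑ γ, χ y γ * pdv γ (fun y => ChrG n hmat y δ α β) y)
      - (∑ γ, pdv γ (fun y => χ y δ) y * ChrG n hmat y γ α β)
      + (∑ γ, ChrG n hmat y δ γ β * pdv α (fun y => χ y γ) y)
      + (∑ γ, ChrG n hmat y δ α γ * pdv β (fun y => χ y γ) y)
      + pdv α (pdv β (fun y => χ y δ)) y = 0 := by
  have diff {f : (Fin n → ℝ) → ℝ} (hf : ContDiff ℝ (⊤ : ℕ∞) f) : DifferentiableAt ℝ f y :=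
    hf.differentiable (by simp) y
  have hh := contDiff_component hsm
  have hχ := contDiff_pi.1 hχsm
  have hG := contDiff_ChrG hsm hinvert
  have hdh (μ α β : Fin n) := contDiff_pdv μ (hh α β)
  have hdχ (μ α : Fin n) := contDiff_pdv μ (hχ α)
  refine congrFun (Matrix.eq_zero_of_mulVec_eq_zero (hinvert y).ne_zero (v := fun δ =>
    (∑ γ, χ y γ * pdv γ (fun y => ChrG n hmat y δ α β) y)
      - (∑ γ, pdv γ (fun y => χ y δ) y * ChrG n hmat y γ α β)
      + (∑ γ, ChrG n hmat y δ γ β * pdv α (fun y => χ y γ) y)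
      + (∑ γ, ChrG n hmat y δ α γ * pdv β (fun y => χ y γ) y)
      + pdv α (pdv β (fun y => χ y δ)) y) (funext fun ζ => ?_)) δ
  refine lowered_lieDeriv_christoffel_eq_zero (h := hmat y)
    (dh := fun μ α β => pdv μ (fun y => hmat y α β) y)
    (ddh := fun μ ν α β => pdv μ (pdv ν (fun y => hmat y α β)) y) (c := χ y)
    (dc := fun μ α => pdv μ (fun y => χ y α) y)
    (ddc := fun μ ν α => pdv μ (pdv ν (fun y => χ y α)) y) (G := ChrG n hmat y)
    (dG := fun μ δ α β => pdv μ (fun y => ChrG n hmat y δ α β) y) (hsym y) (fun μ α β => ?_)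
    (fun μ ν α β => pdv_comm μ ν (hh α β)) (fun μ ν α => pdv_comm μ ν (hχ α))
    (hkilling y) (fun μ α β => ?_) (sum_metric_mul_ChrG (hinvert y)) (fun μ δ α β => ?_) ζ α β
  · simp only [hsym _ α β]
  · rw [← pdv_const (x := y) μ 0, ← funext fun y => hkilling y α β, pdv_sum]
    · refine Finset.sum_congr rfl fun γ _ => ?_
      rw [pdv_add μ (diff (((hχ γ).mul (hdh γ α β)).add ((hh γ β).mul (hdχ α γ))))
          (diff ((hh α γ).mul (hdχ β γ))),
        pdv_add μ (diff ((hχ γ).mul (hdh γ α β))) (diff ((hh γ β).mul (hdχ α γ))),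
        pdv_mul μ (diff (hχ γ)) (diff (hdh γ α β)), pdv_mul μ (diff (hh γ β)) (diff (hdχ α γ)),
        pdv_mul μ (diff (hh α γ)) (diff (hdχ β γ))]
    · exact fun γ => diff ((((hχ γ).mul (hdh γ α β)).add ((hh γ β).mul (hdχ α γ))).add
        ((hh α γ).mul (hdχ β γ)))
  · rw [← pdv_add μ (diff (hdh α δ β)) (diff (hdh β δ α)),
      ← pdv_sub μ (diff ((hdh α δ β).add (hdh β δ α))) (diff (hdh δ α β)),
      ← pdv_const_mul μ (1/2) (diff (((hdh α δ β).add (hdh β δ α)).sub (hdh δ α β))),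
      ← funext fun y => sum_metric_mul_ChrG (hinvert y) δ α β,
      pdv_sum μ fun ε => diff ((hh δ ε).mul (hG ε α β))]
    exact Finset.sum_congr rfl fun ε _ => (pdv_mul μ (diff (hh δ ε)) (diff (hG ε α β))).symm

end Christoffel

section LieDerivative

variable {n : ℕ} {ν₀ : ℝ} {hmat kmat : (Fin n → ℝ) → Fin n → Fin n → ℝ}
  {ω : (Fin n → ℝ) → ℝ} {χ : (Fin n → ℝ) → Fin n → ℝ}

lemma Γind_zero_lower_left (x : Fin (n + 1) → ℝ) (a c : Fin (n + 1)) :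
    Γind n ν₀ hmat kmat x a 0 c = 0 := by
  cases a using Fin.cases <;> rfl

lemma Γind_zero_lower_right (x : Fin (n + 1) → ℝ) (a b : Fin (n + 1)) :
    Γind n ν₀ hmat kmat x a b 0 = 0 := by
  cases a using Fin.cases <;> cases b using Fin.cases <;> rfl

lemma Γind_zero_succ_succ (x : Fin (n + 1) → ℝ) (β γ : Fin n) :
    Γind n ν₀ hmat kmat x 0 β.succ γ.succ
      = ν₀ * ((1/2) * kmat (x ∘ Fin.succ) β γ + x 0 * hmat (x ∘ Fin.succ) β γ) := rfl

lemma Γind_succ_succ_succ (x : Fin (n + 1) → ℝ) (α β γ : Fin n) :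
    Γind n ν₀ hmat kmat x α.succ β.succ γ.succ = ChrG n hmat (x ∘ Fin.succ) α β γ := rfl

lemma XfieldTi_zero (x : Fin (n + 1) → ℝ) : XfieldTi n ω χ x 0 = ω (x ∘ Fin.succ) := rfl

lemma XfieldTi_succ (x : Fin (n + 1) → ℝ) (α : Fin n) :
    XfieldTi n ω χ x α.succ = χ (x ∘ Fin.succ) α := rfl

lemma exists_XfieldTi_component_eq (hω : ContDiff ℝ (⊤ : ℕ∞) ω) (hχ : ContDiff ℝ (⊤ : ℕ∞) χ)
    (a : Fin (n + 1)) : ∃ f : (Fin n → ℝ) → ℝ, ContDiff ℝ (⊤ : ℕ∞) f ∧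
      (fun x => XfieldTi n ω χ x a) = fun x => f (x ∘ Fin.succ) := by
  cases a using Fin.cases with
  | zero => exact ⟨ω, hω, rfl⟩
  | succ α => exact ⟨fun y => χ y α, contDiff_pi.1 hχ α, rfl⟩

lemma pdv_zero_XfieldTi (hω : ContDiff ℝ (⊤ : ℕ∞) ω) (hχ : ContDiff ℝ (⊤ : ℕ∞) χ)
    (a : Fin (n + 1)) (x : Fin (n + 1) → ℝ) : pdv 0 (fun x => XfieldTi n ω χ x a) x = 0 := by
  obtain ⟨f, hf, hfa⟩ := exists_XfieldTi_component_eq hω hχ a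
  rw [hfa, pdv_zero_comp_succ x (hf.differentiable (by simp) _)]

lemma pdv_pdv_comp_succ {f : (Fin n → ℝ) → ℝ} (hf : ContDiff ℝ (⊤ : ℕ∞) f) (β γ : Fin n)
    (x : Fin (n + 1) → ℝ) :
    pdv β.succ (pdv γ.succ fun x : Fin (n + 1) → ℝ => f (x ∘ Fin.succ)) x
      = pdv β (pdv γ f) (x ∘ Fin.succ) := by
  have h1 : pdv γ.succ (fun x : Fin (n + 1) → ℝ => f (x ∘ Fin.succ))
      = fun x => pdv γ f (x ∘ Fin.succ) :=
    funext fun x => pdv_succ_comp_succ γ x (hf.differentiable (by simp) _)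
  rw [h1, pdv_succ_comp_succ β x ((contDiff_pdv γ hf).differentiable (by simp) _)]

lemma LieConn_zero_lower_left (hω : ContDiff ℝ (⊤ : ℕ∞) ω) (hχ : ContDiff ℝ (⊤ : ℕ∞) χ)
    (x : Fin (n + 1) → ℝ) (a c : Fin (n + 1)) :
    LieConn n (Γind n ν₀ hmat kmat) (XfieldTi n ω χ) x a 0 c = 0 := by
  have h2 : pdv 0 (pdv c fun x => XfieldTi n ω χ x a) x = 0 := by
    obtain ⟨f, hf, hfa⟩ := exists_XfieldTi_component_eq hω hχ a
    have hs : ContDiff ℝ (⊤ : ℕ∞) fun x : Fin (n + 1) → ℝ => f (x ∘ Fin.succ) :=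
      hf.comp (contDiff_pi.2 fun i => contDiff_apply ℝ ℝ i.succ)
    have h0 : pdv 0 (fun x : Fin (n + 1) → ℝ => f (x ∘ Fin.succ)) = fun _ => 0 :=
      funext fun x => pdv_zero_comp_succ x (hf.differentiable (by simp) _)
    rw [hfa, pdv_comm _ _ hs, h0, pdv_const]
  simp [LieConn, Γind_zero_lower_left, pdv_const, pdv_zero_XfieldTi hω hχ, h2]

lemma LieConn_zero_lower_right (hω : ContDiff ℝ (⊤ : ℕ∞) ω) (hχ : ContDiff ℝ (⊤ : ℕ∞) χ)
    (x : Fin (n + 1) → ℝ) (a b : Fin (n + 1)) :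
    LieConn n (Γind n ν₀ hmat kmat) (XfieldTi n ω χ) x a b 0 = 0 := by
  have h2 : pdv b (pdv 0 fun x => XfieldTi n ω χ x a) x = 0 := by
    have h0 : pdv 0 (fun x => XfieldTi n ω χ x a) = fun _ => 0 :=
      funext (pdv_zero_XfieldTi hω hχ a)
    rw [h0, pdv_const]
  simp [LieConn, Γind_zero_lower_right, pdv_const, pdv_zero_XfieldTi hω hχ, h2]

lemma LieConn_succ_succ_succ (hsm : ContDiff ℝ (⊤ : ℕ∞) hmat)
    (hinvert : ∀ y : Fin n → ℝ, IsUnit (Matrix.of (hmat y)).det)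
    (hω : ContDiff ℝ (⊤ : ℕ∞) ω) (hχ : ContDiff ℝ (⊤ : ℕ∞) χ)
    (x : Fin (n + 1) → ℝ) (δ α β : Fin n) :
    LieConn n (Γind n ν₀ hmat kmat) (XfieldTi n ω χ) x δ.succ α.succ β.succ
      = (∑ γ, χ (x ∘ Fin.succ) γ * pdv γ (fun y => ChrG n hmat y δ α β) (x ∘ Fin.succ))
        - (∑ γ, pdv γ (fun y => χ y δ) (x ∘ Fin.succ) * ChrG n hmat (x ∘ Fin.succ) γ α β)
        + (∑ γ, ChrG n hmat (x ∘ Fin.succ) δ γ β * pdv α (fun y => χ y γ) (x ∘ Fin.succ))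
        + (∑ γ, ChrG n hmat (x ∘ Fin.succ) δ α γ * pdv β (fun y => χ y γ) (x ∘ Fin.succ))
        + pdv α (pdv β (fun y => χ y δ)) (x ∘ Fin.succ) := by
  have hχd (γ : Fin n) (x : Fin (n + 1) → ℝ) :
      DifferentiableAt ℝ (fun y => χ y γ) (x ∘ Fin.succ) :=
    (contDiff_pi.1 hχ γ).differentiable (by simp) _
  have hGd := (contDiff_ChrG hsm hinvert δ α β).differentiable (by simp) (x ∘ Fin.succ)
  simp only [LieConn, Fin.sum_univ_succ, Γind_zero_lower_left, Γind_zero_lower_right,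
    pdv_zero_XfieldTi hω hχ, zero_mul, zero_add]
  simp only [Γind_succ_succ_succ, XfieldTi_succ,
    pdv_zero_comp_succ (f := fun y => ChrG n hmat y δ α β) x hGd,
    pdv_succ_comp_succ (f := fun y => ChrG n hmat y δ α β) _ x hGd,
    pdv_succ_comp_succ (f := fun y => χ y _) _ x (hχd _ x),
    pdv_pdv_comp_succ (f := fun y => χ y δ) (contDiff_pi.1 hχ δ), mul_zero, zero_add]

lemma pdv_Γind_zero (hsm : ContDiff ℝ (⊤ : ℕ∞) hmat) (ksm : ContDiff ℝ (⊤ : ℕ∞) kmat)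
    (x : Fin (n + 1) → ℝ) (i : Fin (n + 1)) (β γ : Fin n) :
    pdv i (fun x => Γind n ν₀ hmat kmat x 0 β.succ γ.succ) x
      = ν₀ * ((1/2) * pdv i (fun x => kmat (x ∘ Fin.succ) β γ) x
        + (pdv i (fun x => x 0) x * hmat (x ∘ Fin.succ) β γ
          + x 0 * pdv i (fun x => hmat (x ∘ Fin.succ) β γ) x)) := by
  have hh : DifferentiableAt ℝ (fun x : Fin (n + 1) → ℝ => hmat (x ∘ Fin.succ) β γ) x :=
    (hasFDerivAt_comp_succ (f := fun y => hmat y β γ) x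
      ((contDiff_component hsm β γ).differentiable (by simp) _)).differentiableAt
  have hk : DifferentiableAt ℝ (fun x : Fin (n + 1) → ℝ => kmat (x ∘ Fin.succ) β γ) x :=
    (hasFDerivAt_comp_succ (f := fun y => kmat y β γ) x
      ((contDiff_component ksm β γ).differentiable (by simp) _)).differentiableAt
  have hu : DifferentiableAt ℝ (fun x : Fin (n + 1) → ℝ => x 0) x := differentiableAt_apply 0 x
  rw [← pdv_mul i hu hh, ← pdv_const_mul i _ hk, ← pdv_add i (hk.const_mul _) (hu.fun_mul hh),
    ← pdv_const_mul i _ ((hk.const_mul _).fun_add (hu.fun_mul hh))]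
  rfl

lemma LieConn_zero_succ_succ (hsm : ContDiff ℝ (⊤ : ℕ∞) hmat) (ksm : ContDiff ℝ (⊤ : ℕ∞) kmat)
    (hω : ContDiff ℝ (⊤ : ℕ∞) ω) (hχ : ContDiff ℝ (⊤ : ℕ∞) χ)
    (hkilling : ∀ (y : Fin n → ℝ) (α β : Fin n),
      ∑ γ, (χ y γ * pdv γ (fun y => hmat y α β) y
        + hmat y γ β * pdv α (fun y => χ y γ) y
        + hmat y α γ * pdv β (fun y => χ y γ) y) = 0)
    (x : Fin (n + 1) → ℝ) {y : Fin n → ℝ} (hy : x ∘ Fin.succ = y) (β γ : Fin n) :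
    LieConn n (Γind n ν₀ hmat kmat) (XfieldTi n ω χ) x 0 β.succ γ.succ
      = (pdv β (pdv γ ω) y - ∑ δ, ChrG n hmat y δ β γ * pdv δ ω y) + ν₀ * hmat y β γ * ω y
        + (ν₀/2) * ∑ δ, (χ y δ * pdv δ (fun y => kmat y β γ) y
          + kmat y δ γ * pdv β (fun y => χ y δ) y
          + kmat y β δ * pdv γ (fun y => χ y δ) y) := by
  subst hy
  have hχd (γ : Fin n) : DifferentiableAt ℝ (fun y => χ y γ) (x ∘ Fin.succ) :=
    (contDiff_pi.1 hχ γ).differentiable (by simp) _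
  have hωd := hω.differentiable (by simp) (x ∘ Fin.succ)
  have hh := (contDiff_component hsm β γ).differentiable (by simp) (x ∘ Fin.succ)
  have hk := (contDiff_component ksm β γ).differentiable (by simp) (x ∘ Fin.succ)
  have hK := congrArg (fun t => ν₀ * x 0 * t) (hkilling (x ∘ Fin.succ) β γ)
  simp only [LieConn, Fin.sum_univ_succ, Γind_zero_lower_left, Γind_zero_lower_right,
    pdv_Γind_zero hsm ksm, pdv_zero_XfieldTi hω hχ, pdv_zero_coord, pdv_succ_coord_zero,
    zero_mul, zero_add, one_mul]
  simp only [Γind_zero_succ_succ, Γind_succ_succ_succ, XfieldTi_zero, XfieldTi_succ,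
    pdv_zero_comp_succ (f := fun y => hmat y β γ) x hh,
    pdv_zero_comp_succ (f := fun y => kmat y β γ) x hk,
    pdv_succ_comp_succ (f := fun y => hmat y β γ) _ x hh,
    pdv_succ_comp_succ (f := fun y => kmat y β γ) _ x hk,
    pdv_succ_comp_succ (f := fun y => χ y _) _ x (hχd _), pdv_succ_comp_succ _ x hωd,
    pdv_pdv_comp_succ hω, mul_zero, zero_add, add_zero, mul_comm (ChrG n hmat _ _ _ _)]
  simp only [mul_add, add_mul, Finset.mul_sum, Finset.sum_add_distrib] at hK ⊢
  ring_nf at hK ⊢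
  linarith

end LieDerivative

/-- For `X = ω(y)∂_u + χ^α(y)∂_α` with `χ` a Killing vector of the constant-curvature
metric `h`, `X` is an automorphism of the induced strongly Carrollian geometry
(`L_XΓ = 0`) if and only if `D_βD_γω + ν₀h_{βγ}ω = -(ν₀/2)(L_χk)_{βγ}`. -/
theorem carroll_connection_automorphism_iff
    (n : ℕ) (hn : 1 ≤ n) (ν₀ : ℝ)
    (hmat : (Fin n → ℝ) → Fin n → Fin n → ℝ)
    (hsm : ContDiff ℝ (⊤ : ℕ∞) hmat)
    (hsym : ∀ (y : Fin n → ℝ) (α β : Fin n), hmat y α β = hmat y β α)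
    (hinvert : ∀ y : Fin n → ℝ, IsUnit (Matrix.of (hmat y)).det)
    (hconst : ∀ (y : Fin n → ℝ) (α β γ δ : Fin n),
      Riem n hmat y α β γ δ
        = ν₀ * ((if α = γ then 1 else 0) * hmat y δ β
            - (if α = δ then 1 else 0) * hmat y γ β))
    (kmat : (Fin n → ℝ) → Fin n → Fin n → ℝ)
    (ksm : ContDiff ℝ (⊤ : ℕ∞) kmat)
    (ksym : ∀ (y : Fin n → ℝ) (α β : Fin n), kmat y α β = kmat y β α)
    (ω : (Fin n → ℝ) → ℝ) (hωsm : ContDiff ℝ (⊤ : ℕ∞) ω)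
    (χ : (Fin n → ℝ) → Fin n → ℝ) (hχsm : ContDiff ℝ (⊤ : ℕ∞) χ)
    (hkilling : ∀ (y : Fin n → ℝ) (α β : Fin n),
      ∑ γ, (χ y γ * pdv γ (fun y => hmat y α β) y
        + hmat y γ β * pdv α (fun y => χ y γ) y
        + hmat y α γ * pdv β (fun y => χ y γ) y) = 0) :
    (∀ (x : Fin (n+1) → ℝ) (a b c : Fin (n+1)),
        LieConn n (Γind n ν₀ hmat kmat) (XfieldTi n ω χ) x a b c = 0)
      ↔ (∀ (y : Fin n → ℝ) (β γ : Fin n),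
          (pdv β (pdv γ ω) y - ∑ δ, ChrG n hmat y δ β γ * pdv δ ω y)
              + ν₀ * hmat y β γ * ω y
            = -(ν₀/2) * ∑ δ, (χ y δ * pdv δ (fun y => kmat y β γ) y
                + kmat y δ γ * pdv β (fun y => χ y δ) y
                + kmat y β δ * pdv γ (fun y => χ y δ) y)) := by
  have hfib (x : Fin (n+1) → ℝ) {y : Fin n → ℝ} (hy : x ∘ Fin.succ = y) (β γ : Fin n) :=
    LieConn_zero_succ_succ (ν₀ := ν₀) hsm ksm hωsm hχsm hkilling x hy β γ
  constructor
  · intro h y β γ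
    have h0 := hfib (Fin.cons 0 y) (y := y) rfl β γ
    rw [h] at h0
    linarith
  · intro h x a b c
    cases b using Fin.cases with
    | zero => exact LieConn_zero_lower_left hωsm hχsm x a c
    | succ β =>
      cases c using Fin.cases with
      | zero => exact LieConn_zero_lower_right hωsm hχsm x a β.succ
      | succ γ =>
        cases a using Fin.cases with
        | zero =>
          rw [hfib x rfl, h]
          ring
        | succ α =>
          rw [LieConn_succ_succ_succ hsm hinvert hωsm hχsm]
          exact lieDeriv_ChrG_eq_zero_of_killing hsm hsym hinvert hχsm hkilling _ α β γ
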